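/- arXiv:cond-mat/9809228 — 4 statements merged into one kernel-verified Lean document; each statement's English description precedes it below -/
import Mathlib

section
/- Lemma 3.1 (first part). For every n ∈ ℕ and every k ∈ ℝ, the periodized Landau eigenfunction φ^P_{n,k} is an eigenvector of the magnetic translation t^{(x)}(Δx): for all (x,y) ∈ ℝ² one has φ^P_{n,k}(x − Δx, y) = exp(−i k Δx) · φ^P_{n,k}(x, y). In particular, if k = 2πm/L_x with m ∈ ℤ, the eigenvalue equals exp(−2πi m/M). -/
open MeasureTheory Real

noncomputable def physHermite : ℕ → Polynomial ℝ
  | 0 => 1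
  | n + 1 => 2 * Polynomial.X * physHermite n - Polynomial.derivative (physHermite n)

/-- The harmonic-oscillator profile function `v_n` centered at `yk`. -/
noncomputable def landauV (N : ℕ → ℝ) (lB : ℝ) (n : ℕ) (yk y : ℝ) : ℝ :=
  N n * Real.exp (-(y - yk) ^ 2 / (2 * lB ^ 2)) * (physHermite n).eval ((y - yk) / lB)

/-- The periodized Landau eigenfunction `φ^P_{n,k}` (here `K = L_y/ℓ_B² = L_y·eB/ℏ`
and `y_k = ℏk/(eB)`). -/
noncomputable def phiP (N : ℕ → ℝ) (hbar e B Lx Ly : ℝ) (n : ℕ) (k x y : ℝ) : ℂ :=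
  (Real.sqrt Lx)⁻¹ *
    ∑' ℓ : ℤ,
      Complex.exp (Complex.I * (((k + ℓ * (Ly * (e * B / hbar))) * x : ℝ) : ℂ)) *
        ((landauV N (Real.sqrt (hbar / (e * B))) n (hbar * k / (e * B)) (y - ℓ * Ly) : ℝ) : ℂ)

/-- A translation in `x` by `d` with `K d = 2π`, where `K = L_y eB/ℏ`, multiplies `φ^P_{n,k}` by
`e^{-ikd}`. -/
theorem phiP_sub_of_mul_eq_two_pi (N : ℕ → ℝ) (hbar e B Lx Ly : ℝ) (n : ℕ) (k x y d : ℝ)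
    (hd : Ly * (e * B / hbar) * d = 2 * Real.pi) :
    phiP N hbar e B Lx Ly n k (x - d) y
      = Complex.exp (-(Complex.I * (k : ℂ) * (d : ℂ))) * phiP N hbar e B Lx Ly n k x y := by
  unfold phiP
  simp only [← tsum_mul_left]
  refine tsum_congr fun ℓ => ?_
  rw [mul_left_comm (Complex.exp _)]
  congr 1
  rw [← mul_assoc (Complex.exp _) (Complex.exp _)]
  congr 1
  rw [← Complex.exp_add, Complex.exp_eq_exp_iff_exists_int]
  refine ⟨-ℓ, ?_⟩
  have h : (k + ℓ * (Ly * (e * B / hbar))) * (x - d)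
      = -(k * d) + (k + ℓ * (Ly * (e * B / hbar))) * x - ℓ * (2 * Real.pi) := by
    rw [← hd]; ring
  rw [h]
  push_cast
  ring

/-- **Lemma 3.1 (first part).** `φ^P_{n,k}` is an eigenvector of the magnetic
translation `t^{(x)}(Δx)`: `φ^P_{n,k}(x − Δx, y) = e^{−ikΔx} φ^P_{n,k}(x,y)`, and for
`k = 2πm/L_x` the eigenvalue equals `e^{−2πim/M}`. -/
theorem phiP_magnetic_translation_x
    (hbar e B : ℝ) (hhbar : 0 < hbar) (he : 0 < e) (hB : 0 < B)
    (N : ℕ → ℝ)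
    (hN : ∀ (n : ℕ) (k : ℝ), 0 < N n ∧
      ∫ y : ℝ, (landauV N (Real.sqrt (hbar / (e * B))) n (hbar * k / (e * B)) y) ^ 2 = 1)
    (Lx Ly : ℝ) (hLx : 0 < Lx) (hLy : 0 < Ly)
    (M : ℕ) (hM : 0 < M) (hMeven : Even M)
    (hbox : Lx * Ly = 2 * Real.pi * M * Real.sqrt (hbar / (e * B)) ^ 2)
    (Δx : ℝ) (hΔx : Δx = 2 * Real.pi * Real.sqrt (hbar / (e * B)) ^ 2 / Ly) :
    ∀ (n : ℕ) (k : ℝ),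
      (∀ x y : ℝ,
        phiP N hbar e B Lx Ly n k (x - Δx) y
          = Complex.exp (-(Complex.I * (k : ℂ) * (Δx : ℂ))) * phiP N hbar e B Lx Ly n k x y)
      ∧ ∀ m : ℤ, k = 2 * Real.pi * m / Lx →
          Complex.exp (-(Complex.I * (k : ℂ) * (Δx : ℂ)))
            = Complex.exp (-(2 * Real.pi * Complex.I * (m : ℂ) / (M : ℂ))) := by
  have hsq : Real.sqrt (hbar / (e * B)) ^ 2 = hbar / (e * B) := Real.sq_sqrt (by positivity)
  rw [hsq] at hbox hΔx
  intro n k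
  refine ⟨fun x y => phiP_sub_of_mul_eq_two_pi N hbar e B Lx Ly n k x y Δx ?_, ?_⟩
  · rw [hΔx]
    field_simp
  · intro m hk
    have hM' : (M : ℝ) ≠ 0 := by positivity
    have hprod : k * Δx = 2 * Real.pi * m / M := by
      calc k * Δx = 2 * Real.pi * m * (2 * Real.pi * (hbar / (e * B))) / (Lx * Ly) := by
            rw [hk, hΔx]; field_simp
        _ = 2 * Real.pi * m / M := by
            rw [hbox]; field_simp
    rw [mul_assoc, ← Complex.ofReal_mul, hprod]
    congr 1
    push_cast
    ring
end

section
/- Lemma 3.1 (second part). For every n ∈ ℕ and every k ∈ ℝ, the magnetic translation t^{(y)}(Δy) shifts the wavenumber of φ^P_{n,k} by one unit 2π/L_x: for all (x,y) ∈ ℝ² one has exp(i Δy · x/ℓ_B²) · φ^P_{n,k}(x, y − Δy) = φ^P_{n,k'}(x, y), where k' = k + 2π/L_x. -/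
open MeasureTheory Real

/-- The oscillator profile depends only on the displacement from its center. -/
theorem landauV_congr_sub (N : ℕ → ℝ) (lB : ℝ) (n : ℕ) {yk y yk' y' : ℝ}
    (h : y - yk = y' - yk') : landauV N lB n yk y = landauV N lB n yk' y' := by
  unfold landauV
  rw [h]

/-- **Lemma 3.1 (second part).** The magnetic translation `t^{(y)}(Δy)` shifts the
wavenumber of `φ^P_{n,k}` by one unit `2π/L_x`: for all `(x,y)`,
`e^{iΔy·x/ℓ_B²} φ^P_{n,k}(x, y − Δy) = φ^P_{n,k'}(x, y)` with `k' = k + 2π/L_x`. -/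
theorem phiP_magnetic_translation_y
    (hbar e B : ℝ) (hhbar : 0 < hbar) (he : 0 < e) (hB : 0 < B)
    (N : ℕ → ℝ)
    (hN : ∀ (n : ℕ) (k : ℝ), 0 < N n ∧
      ∫ y : ℝ, (landauV N (Real.sqrt (hbar / (e * B))) n (hbar * k / (e * B)) y) ^ 2 = 1)
    (Lx Ly : ℝ) (hLx : 0 < Lx) (hLy : 0 < Ly)
    (Δy : ℝ) (hΔy : Δy = 2 * Real.pi * Real.sqrt (hbar / (e * B)) ^ 2 / Lx) :
    ∀ (n : ℕ) (k : ℝ) (x y : ℝ),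
      Complex.exp (Complex.I * ((Δy * x / Real.sqrt (hbar / (e * B)) ^ 2 : ℝ) : ℂ)) *
          phiP N hbar e B Lx Ly n k x (y - Δy)
        = phiP N hbar e B Lx Ly n (k + 2 * Real.pi / Lx) x y := by
  intro n k x y
  have hl : Real.sqrt (hbar / (e * B)) ^ 2 = hbar / (e * B) := Real.sq_sqrt (by positivity)
  have hphase : Δy * x / Real.sqrt (hbar / (e * B)) ^ 2 = 2 * Real.pi / Lx * x := by
    rw [hΔy, hl]
    field_simp
  have hshift : Δy = hbar * (k + 2 * Real.pi / Lx) / (e * B) - hbar * k / (e * B) := by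
    rw [hΔy, hl]
    field_simp
    ring
  rw [hphase]
  unfold phiP
  rw [mul_left_comm, ← tsum_mul_left]
  congr 1
  refine tsum_congr fun ℓ => ?_
  rw [← mul_assoc, ← Complex.exp_add, ← mul_add, ← Complex.ofReal_add]
  congr 2
  · congr 3
    ring
  · apply landauV_congr_sub
    rw [hshift]
    ring
end

section
/- Quantization of x-translations compatible with the periodic boundary conditions: let ℓ_B, L_x, L_y > 0, let f : ℝ² → ℂ satisfy the magnetic periodic boundary conditions, suppose f(x₀, y₀) ≠ 0 for some point (x₀, y₀) ∈ ℝ², and suppose that the translated function f₁ := t^{(x)}(x')f also satisfies the magnetic periodic boundary conditions. Then L_y x'/ℓ_B² ∈ 2πℤ; equivalently, x' = m Δx for some m ∈ ℤ, where Δx = 2πℓ_B²/L_y. -/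
open Real

/-- The magnetic translation `t^{(x)}(x')` acting on functions on `ℝ²`. -/
def magT_x (x' : ℝ) (f : ℝ × ℝ → ℂ) : ℝ × ℝ → ℂ :=
  fun p => f (p.1 - x', p.2)

/-- `f` satisfies the magnetic periodic boundary conditions on the `L_x × L_y` box
(with magnetic length `lB`). -/
def MagneticPBC (lB Lx Ly : ℝ) (f : ℝ × ℝ → ℂ) : Prop :=
  ∀ x y : ℝ, f (x - Lx, y) = f (x, y) ∧
    Complex.exp (Complex.I * ((Ly * x / lB ^ 2 : ℝ) : ℂ)) * f (x, y - Ly) = f (x, y)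

/-- **Quantization of `x`-translations compatible with the periodic boundary
conditions:** if a not-identically-vanishing `f` and its translate `t^{(x)}(x')f` both
satisfy the magnetic periodic boundary conditions, then `L_y x'/ℓ_B² ∈ 2πℤ`, i.e.
`x' = mΔx` with `Δx = 2πℓ_B²/L_y`. -/
theorem x_translation_quantization
    (lB Lx Ly : ℝ) (hlB : 0 < lB) (hLx : 0 < Lx) (hLy : 0 < Ly)
    (f : ℝ × ℝ → ℂ) (hf : MagneticPBC lB Lx Ly f)
    (x₀ y₀ : ℝ) (hf0 : f (x₀, y₀) ≠ 0)
    (x' : ℝ) (hf1 : MagneticPBC lB Lx Ly (magT_x x' f)) :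
    ∃ m : ℤ, Ly * x' / lB ^ 2 = 2 * Real.pi * m ∧
      x' = m * (2 * Real.pi * lB ^ 2 / Ly) := by
  have h0 := (hf x₀ y₀).2
  have h1 := (hf1 (x₀ + x') y₀).2
  simp only [magT_x, add_sub_cancel_right] at h1
  have hne : f (x₀, y₀ - Ly) ≠ 0 := fun h => hf0 (by rw [← h0, h, mul_zero])
  obtain ⟨m, hm⟩ := Complex.exp_eq_exp_iff_exists_int.1
    (mul_right_cancel₀ hne (h1.trans h0.symm))
  have hphase : Ly * (x₀ + x') / lB ^ 2 = Ly * x₀ / lB ^ 2 + m * (2 * π) := by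
    apply Complex.ofReal_injective
    apply mul_left_cancel₀ Complex.I_ne_zero
    rw [hm]
    push_cast
    ring
  have hquant : Ly * x' / lB ^ 2 = 2 * π * m := by
    rw [mul_add, add_div] at hphase
    linarith
  refine ⟨m, hquant, ?_⟩
  field_simp at hquant ⊢
  linarith
end

section
/- Quantization of y-translations compatible with the periodic boundary conditions: let ℓ_B, L_x, L_y > 0, let f : ℝ² → ℂ satisfy the magnetic periodic boundary conditions, suppose f(x₀, y₀) ≠ 0 for some point (x₀, y₀) ∈ ℝ², and suppose that the translated function f₂ := t^{(y)}(y')f also satisfies the magnetic periodic boundary conditions. Then y' L_x/ℓ_B² ∈ 2πℤ; equivalently, y' = n Δy for some n ∈ ℤ, where Δy = 2πℓ_B²/L_x. -/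
open Real

/-- The magnetic translation `t^{(y)}(y')` (with magnetic length `lB`) acting on
functions on `ℝ²`. -/
noncomputable def magT_y (lB y' : ℝ) (f : ℝ × ℝ → ℂ) : ℝ × ℝ → ℂ :=
  fun p => Complex.exp (Complex.I * ((y' * p.1 / lB ^ 2 : ℝ) : ℂ)) * f (p.1, p.2 - y')

/-- **Quantization of `y`-translations compatible with the periodic boundary
conditions:** if a not-identically-vanishing `f` and its translate `t^{(y)}(y')f` both
satisfy the magnetic periodic boundary conditions, then `y' L_x/ℓ_B² ∈ 2πℤ`, i.e.
`y' = nΔy` with `Δy = 2πℓ_B²/L_x`. -/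
theorem y_translation_quantization
    (lB Lx Ly : ℝ) (hlB : 0 < lB) (hLx : 0 < Lx) (hLy : 0 < Ly)
    (f : ℝ × ℝ → ℂ) (hf : MagneticPBC lB Lx Ly f)
    (x₀ y₀ : ℝ) (hf0 : f (x₀, y₀) ≠ 0)
    (y' : ℝ) (hf2 : MagneticPBC lB Lx Ly (magT_y lB y' f)) :
    ∃ n : ℤ, y' * Lx / lB ^ 2 = 2 * Real.pi * n ∧
      y' = n * (2 * Real.pi * lB ^ 2 / Lx) := by
  have h := (hf2 x₀ (y₀ + y')).1
  simp only [magT_y, add_sub_cancel_right, (hf x₀ y₀).1] at h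
  obtain ⟨n, hn⟩ := Complex.exp_eq_exp_iff_exists_int.1 (mul_right_cancel₀ hf0 h).symm
  have hn' : Complex.I * ((y' * x₀ / lB ^ 2 : ℝ) : ℂ) =
      Complex.I * ((y' * (x₀ - Lx) / lB ^ 2 + n * (2 * Real.pi) : ℝ) : ℂ) := by
    rw [hn]
    push_cast
    ring
  have hreal : y' * x₀ / lB ^ 2 = y' * (x₀ - Lx) / lB ^ 2 + n * (2 * Real.pi) :=
    Complex.ofReal_injective (mul_left_cancel₀ Complex.I_ne_zero hn')
  have hquant : y' * Lx / lB ^ 2 = 2 * Real.pi * n := by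
    linear_combination hreal
  refine ⟨n, hquant, ?_⟩
  have hlB' := hlB.ne'
  have hLx' := hLx.ne'
  field_simp at hquant ⊢
  linear_combination hquant
end
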